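/- Let G be a simple graph on n vertices with two longest paths P and Q such that V(G) = V(P) ∪ V(Q), where P = p₁p₂⋯p_{n−1} (so both P and Q have n − 1 vertices and length n − 2), V(P) \ V(Q) = {p_i} with 1 < i < n − 1, V(Q) \ V(P) = {q}, q is adjacent in G to p_i, and the two edges of Q incident to q join q to p_j and p_k, where 1 < j < k < n − 1 and |i − j| > 1, |k − i| > 1, |k − j| > 1. Then for each x ∈ {j, k}: if x > i then {p₁, p_{x−1}} is not an edge of Q, and if x < i then {p_{x+1}, p_{n−1}} is not an edge of Q. -/

import Mathlib

open SimpleGraph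

/-- `P` is a longest path in the simple graph `G`: it is a path, and every path in `G`
has length at most the length of `P`. -/
def IsLongestPath {V : Type*} (G : SimpleGraph V) {u v : V} (P : G.Walk u v) : Prop :=
  P.IsPath ∧ ∀ {a b : V} (Q : G.Walk a b), Q.IsPath → Q.length ≤ P.length

/-- No repetition-free chain of adjacent vertices is longer than the support of a longest path. -/
theorem IsLongestPath.length_le_of_isChain {V : Type*} {G : SimpleGraph V} {u v : V}
    {P : G.Walk u v} (hP : IsLongestPath G P) {l : List V} (hchain : l.IsChain G.Adj)
    (hnodup : l.Nodup) : l.length ≤ P.support.length := by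
  rcases eq_or_ne l [] with rfl | hne
  · simp
  · have h := hP.2 (Walk.ofSupport l hne hchain)
      (Walk.isPath_def _ |>.2 <| by rwa [Walk.support_ofSupport])
    rw [Walk.length_ofSupport] at h
    rw [Walk.length_support]
    omega

/-- The vertices of a longest path, together with a vertex outside it, cannot be rearranged
into a chain of adjacent vertices. -/
theorem IsLongestPath.not_isChain_of_perm {V : Type*} {G : SimpleGraph V} {u v : V}
    {P : G.Walk u v} (hP : IsLongestPath G P) {q : V} (hq : q ∉ P.support) {l : List V}
    (hl : l.Perm (q :: P.support)) : ¬ l.IsChain G.Adj := fun hchain => by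
  have h := hP.length_le_of_isChain hchain
    (hl.nodup_iff.2 <| List.nodup_cons.2 ⟨hq, hP.1.support_nodup⟩)
  rw [hl.length_eq, List.length_cons] at h
  omega

theorem List.map_range'_eq_append_append {α : Type*} (p : ℕ → α) {a b m : ℕ} (hab : a ≤ b)
    (hbm : b ≤ m) :
    (List.range' 1 m).map p = (List.range' 1 a).map p ++ (List.range' (a + 1) (b - a)).map p ++
      (List.range' (b + 1) (m - b)).map p := by
  obtain ⟨c, rfl⟩ := Nat.exists_eq_add_of_le hab
  obtain ⟨d, rfl⟩ := Nat.exists_eq_add_of_le hbm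
  simp only [Nat.add_sub_cancel_left, ← List.map_append]
  rw [Nat.add_comm a 1, List.range'_append_1, Nat.add_comm (a + c) 1, List.range'_append_1]

/-- If `q` lies outside the longest path `p 1, …, p m` and is adjacent to `p a` and `p (b + 1)`,
then `p 1` and `p b` are not adjacent. -/
theorem IsLongestPath.not_adj_first {V : Type*} {G : SimpleGraph V} {u v : V}
    {P : G.Walk u v} (hP : IsLongestPath G P) {p : ℕ → V} {m : ℕ}
    (hsupp : P.support = (List.range' 1 m).map p) {q : V} (hq : q ∉ P.support) {a b : ℕ}
    (ha : 0 < a) (hab : a < b) (hbm : b < m) (hqa : G.Adj q (p a)) (hqb : G.Adj q (p (b + 1))) :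
    ¬ G.Adj (p 1) (p b) := fun h => by
  have hchain := P.isChain_adj_support
  rw [hsupp, List.map_range'_eq_append_append p hab.le hbm.le, List.isChain_append,
    List.isChain_append] at hchain
  obtain ⟨⟨hA, hB, -⟩, hC, -⟩ := hchain
  refine hP.not_isChain_of_perm hq (l := (List.range' (a + 1) (b - a)).map p ++
    ((List.range' 1 a).map p ++ q :: (List.range' (b + 1) (m - b)).map p)) ?_ ?_
  · rw [hsupp, List.map_range'_eq_append_append p hab.le hbm.le, ← List.append_assoc]
    exact List.perm_middle.trans ((List.perm_append_comm.append_right _).cons q)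
  · have e : a + 1 + (b - a) - 1 = b := by omega
    have hba : b - a ≠ 0 := by omega
    have hmb : m - b ≠ 0 := by omega
    simp [List.isChain_append, List.isChain_cons, hA, hB, hC, List.getLast?_range',
      List.head?_range', ha.ne', hba, hmb, e, h.symm, hqa.symm, hqb]

/-- If `q` lies outside the longest path `p 1, …, p m` and is adjacent to `p a` and `p (b + 1)`,
then `p (a + 1)` and `p m` are not adjacent. -/
theorem IsLongestPath.not_adj_last {V : Type*} {G : SimpleGraph V} {u v : V}
    {P : G.Walk u v} (hP : IsLongestPath G P) {p : ℕ → V} {m : ℕ}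
    (hsupp : P.support = (List.range' 1 m).map p) {q : V} (hq : q ∉ P.support) {a b : ℕ}
    (ha : 0 < a) (hab : a < b) (hbm : b < m) (hqa : G.Adj q (p a)) (hqb : G.Adj q (p (b + 1))) :
    ¬ G.Adj (p (a + 1)) (p m) := fun h => by
  have hchain := P.isChain_adj_support
  rw [hsupp, List.map_range'_eq_append_append p hab.le hbm.le, List.isChain_append,
    List.isChain_append] at hchain
  obtain ⟨⟨hA, hB, -⟩, hC, -⟩ := hchain
  refine hP.not_isChain_of_perm hq (l := (List.range' 1 a).map p ++
    q :: ((List.range' (b + 1) (m - b)).map p ++ (List.range' (a + 1) (b - a)).map p)) ?_ ?_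
  · rw [hsupp, List.map_range'_eq_append_append p hab.le hbm.le, List.append_assoc]
    exact List.perm_middle.trans ((List.perm_append_comm.append_left _).cons q)
  · have e : b + 1 + (m - b) - 1 = m := by omega
    have hba : b - a ≠ 0 := by omega
    have hmb : m - b ≠ 0 := by omega
    simp [List.isChain_append, List.isChain_cons, hA, hB, hC, List.getLast?_range',
      List.head?_range', ha.ne', hba, hmb, e, h.symm, hqa.symm, hqb]

/-- forbidden pairs of vertices that cannot be joined by an edge of `Q`. -/
theorem statement14 {V : Type*} [Fintype V] (G : SimpleGraph V) (n : ℕ)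
    (hcard : Fintype.card V = n)
    {u₁ v₁ u₂ v₂ : V} (P : G.Walk u₁ v₁) (Q : G.Walk u₂ v₂)
    (hP : IsLongestPath G P) (hQ : IsLongestPath G Q)
    (hcover : {x | x ∈ P.support} ∪ {x | x ∈ Q.support} = Set.univ)
    (p : ℕ → V)
    (hsupp : P.support = (List.range (n - 1)).map (fun t => p (t + 1)))
    (i : ℕ) (hi1 : 1 < i) (hi2 : i < n - 1)
    (hPi : {x | x ∈ P.support} \ {x | x ∈ Q.support} = {p i})
    (q : V) (hq : {x | x ∈ Q.support} \ {x | x ∈ P.support} = {q})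
    (hadj : G.Adj q (p i))
    (j k : ℕ) (hj1 : 1 < j) (hjk : j < k) (hk2 : k < n - 1)
    (hqj : s(q, p j) ∈ Q.edges) (hqk : s(q, p k) ∈ Q.edges)
    (hij : 1 < ((i : ℤ) - (j : ℤ)).natAbs)
    (hki : 1 < ((k : ℤ) - (i : ℤ)).natAbs)
    (hkj : 1 < ((k : ℤ) - (j : ℤ)).natAbs) :
    ∀ x : ℕ, (x = j ∨ x = k) →
      (i < x → s(p 1, p (x - 1)) ∉ Q.edges) ∧
      (x < i → s(p (x + 1), p (n - 1)) ∉ Q.edges) := by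
  have hsupp' : P.support = (List.range' 1 (n - 1)).map p := by
    rw [hsupp, List.range'_eq_map_range, List.map_map]
    simp [Function.comp_def, Nat.add_comm]
  have hqP : q ∉ P.support := (hq.ge (Set.mem_singleton q)).2
  intro x hx
  have hqx : G.Adj q (p x) := by
    rcases hx with rfl | rfl <;> exact Q.adj_of_mem_edges ‹_›
  constructor
  · intro hix hmem
    obtain ⟨b, rfl⟩ : ∃ b, x = b + 1 := ⟨x - 1, by omega⟩
    exact hP.not_adj_first hsupp' hqP (by omega) (by omega) (by omega) hadj hqx
      (Q.adj_of_mem_edges hmem)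
  · intro hxi hmem
    obtain ⟨b, rfl⟩ : ∃ b, i = b + 1 := ⟨i - 1, by omega⟩
    exact hP.not_adj_last hsupp' hqP (by omega) (by omega) (by omega) hqx hadj
      (Q.adj_of_mem_edges hmem)
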